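/- Let m ∈ ℝ^{2r}, and let p_1,…,p_r be smooth real-valued functions defined on an open neighborhood V of m with p_i(m) = 0, {p_i,p_j} = 0 on V for all i,j (standard Poisson bracket), and with the differentials d_m p_1,…,d_m p_r linearly independent (equivalently, since the standard Poisson matrix is invertible, the Hamiltonian vector fields X_{p_1},…,X_{p_r} are linearly independent at m). Then there exist an open set U with m ∈ U ⊆ V and smooth functions q_1,…,q_r: U → ℝ such that the map (p_1,q_1,…,p_r,q_r) is a diffeomorphism from U onto an open subset of ℝ^{2r} sending m to 0, and on U one has {q_i,p_j} = δ_{ij} and {q_i,q_j} = 0 for all i,j. -/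

import Mathlib

/-- `ℝ^{2r}` with coordinates `(q₁,…,q_r,p₁,…,p_r)`: the first factor carries the `q`'s and
the second factor the `p`'s. -/
abbrev E2 (r : ℕ) := (Fin r → ℝ) × (Fin r → ℝ)

/-- `∂f/∂q_i`. -/
noncomputable def dq {r : ℕ} (i : Fin r) (f : E2 r → ℝ) (x : E2 r) : ℝ :=
  fderiv ℝ f x (Pi.single i 1, 0)

/-- `∂f/∂p_i`. -/
noncomputable def dp {r : ℕ} (i : Fin r) (f : E2 r → ℝ) (x : E2 r) : ℝ :=
  fderiv ℝ f x (0, Pi.single i 1)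

/-- The standard Poisson bracket `{f,g} = Σ_i (∂f/∂q_i ∂g/∂p_i − ∂g/∂q_i ∂f/∂p_i)`. -/
noncomputable def sbrak {r : ℕ} (f g : E2 r → ℝ) (x : E2 r) : ℝ :=
  ∑ i, (dq i f x * dp i g x - dq i g x * dp i f x)

open scoped ContDiff Topology Matrix
open Set

theorem ContDiff.hasFDerivAt_intervalIntegral {H G : Type*} [NormedAddCommGroup H]
    [NormedSpace ℝ H] [FiniteDimensional ℝ H] [NormedAddCommGroup G] [NormedSpace ℝ G]
    {g : H × ℝ → G} (hg : ContDiff ℝ 1 g) (a b : ℝ) (x₀ : H) :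
    HasFDerivAt (fun x => ∫ t in a..b, g (x, t))
      (∫ t in a..b, (fderiv ℝ g (x₀, t)).comp (ContinuousLinearMap.inl ℝ H ℝ)) x₀ := by
  have : ProperSpace H := FiniteDimensional.proper ℝ H
  have hcont : Continuous fun z : H × ℝ =>
      (fderiv ℝ g z).comp (ContinuousLinearMap.inl ℝ H ℝ) :=
    (hg.continuous_fderiv one_ne_zero).clm_comp continuous_const
  obtain ⟨C, hC⟩ := ((isCompact_closedBall x₀ 1).prod
    (isCompact_uIcc (a := a) (b := b))).exists_bound_of_continuousOn hcont.continuousOn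
  refine intervalIntegral.hasFDerivAt_integral_of_dominated_of_fderiv_le
    (F' := fun x t => (fderiv ℝ g (x, t)).comp (ContinuousLinearMap.inl ℝ H ℝ))
    (bound := fun _ => C)
    (Metric.closedBall_mem_nhds x₀ one_pos) ?_ ?_ ?_ ?_ ?_ ?_
  · exact .of_forall fun x =>
      (hg.continuous.comp (Continuous.prodMk_right x)).aestronglyMeasurable
  · exact (hg.continuous.comp (Continuous.prodMk_right x₀)).intervalIntegrable _ _
  · exact (hcont.comp (Continuous.prodMk_right x₀)).aestronglyMeasurable
  · exact .of_forall fun t ht x hx => hC (x, t) ⟨hx, uIoc_subset_uIcc ht⟩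
  · exact intervalIntegrable_const
  · refine .of_forall fun t _ x _ => ?_
    exact ((hg.differentiable one_ne_zero) (x, t)).hasFDerivAt.comp x (hasFDerivAt_prodMk_left x t)

theorem ContDiff.intervalIntegral_nat {H G : Type} [NormedAddCommGroup H]
    [NormedSpace ℝ H] [FiniteDimensional ℝ H] [NormedAddCommGroup G] [NormedSpace ℝ G]
    {g : H × ℝ → G} (hg : ContDiff ℝ ∞ g) (a b : ℝ) (n : ℕ) :
    ContDiff ℝ n (fun x => ∫ t in a..b, g (x, t)) := by
  induction n generalizing G with
  | zero =>
    refine contDiff_zero.2 (continuous_iff_continuousAt.2 fun x => ?_)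
    exact ((hg.of_le (by simp)).hasFDerivAt_intervalIntegral a b x).continuousAt
  | succ n ih =>
    rw [Nat.cast_succ, contDiff_succ_iff_hasFDerivAt]
    refine ⟨_, ?_, (hg.of_le (by simp)).hasFDerivAt_intervalIntegral a b⟩
    exact ih (g := fun z => (fderiv ℝ g z).comp (ContinuousLinearMap.inl ℝ H ℝ))
      ((contDiff_infty_iff_fderiv.1 hg).2.clm_comp contDiff_const)

theorem ContDiff.intervalIntegral {H G : Type} [NormedAddCommGroup H]
    [NormedSpace ℝ H] [FiniteDimensional ℝ H] [NormedAddCommGroup G] [NormedSpace ℝ G]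
    {g : H × ℝ → G} (hg : ContDiff ℝ ∞ g) (a b : ℝ) :
    ContDiff ℝ ∞ (fun x => ∫ t in a..b, g (x, t)) :=
  contDiff_infty.2 fun n => hg.intervalIntegral_nat a b n

theorem ContDiffOn.exists_contDiff_eqOn_ball {E F : Type*} [NormedAddCommGroup E]
    [NormedSpace ℝ E] [FiniteDimensional ℝ E] [NormedAddCommGroup F] [NormedSpace ℝ F]
    {f : E → F} {W : Set E} {c : E} (hW : IsOpen W) (hc : c ∈ W) (hf : ContDiffOn ℝ ∞ f W) :
    ∃ g : E → F, ContDiff ℝ ∞ g ∧ ∃ ε > 0, Metric.ball c ε ⊆ W ∧ EqOn g f (Metric.ball c ε) := by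
  obtain ⟨ε, hε, hεW⟩ := Metric.nhds_basis_closedBall.mem_iff.1 (hW.mem_nhds hc)
  let χ : ContDiffBump c := ⟨ε / 2, ε, by positivity, by linarith⟩
  refine ⟨fun x => χ x • f x, contDiff_iff_contDiffAt.2 fun x => ?_, ε / 2, by positivity,
    fun x hx => hεW (Metric.ball_subset_closedBall
      (Metric.ball_subset_ball (by linarith) hx)), fun x hx => ?_⟩
  · by_cases hx : x ∈ tsupport χ
    · rw [χ.tsupport_eq] at hx
      exact χ.contDiffAt.smul (hf.contDiffAt (hW.mem_nhds (hεW hx)))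
    · refine (contDiffAt_const (c := (0 : F))).congr_of_eventuallyEq ?_
      filter_upwards [notMem_tsupport_iff_eventuallyEq.1 hx] with y hy
      simp [hy]
  · simp [χ.one_of_mem_closedBall (Metric.ball_subset_closedBall hx)]

/-- A smooth family of closed `1`-forms has, locally, a smooth family of primitives. -/
theorem exists_contDiff_partial_primitive {X Y : Type} [NormedAddCommGroup X]
    [NormedSpace ℝ X] [FiniteDimensional ℝ X] [NormedAddCommGroup Y] [NormedSpace ℝ Y]
    [FiniteDimensional ℝ Y] {g : X × Y → X →L[ℝ] ℝ} {W : Set (X × Y)} {c : X × Y}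
    (hW : IsOpen W) (hc : c ∈ W) (hg : ContDiffOn ℝ ∞ g W)
    (hsymm : ∀ z ∈ W, ∀ u v : X, fderiv ℝ g z (u, 0) v = fderiv ℝ g z (v, 0) u) :
    ∃ S : X × Y → ℝ, ContDiff ℝ ∞ S ∧ ∃ W' ⊆ W, IsOpen W' ∧ c ∈ W' ∧
      ∀ z ∈ W', ∀ v : X, fderiv ℝ S z (v, 0) = g z v := by
  obtain ⟨G, hG, ε, hε, hεW, hGg⟩ := hg.exists_contDiff_eqOn_ball hW hc
  let φ : (X × Y) × ℝ → X × Y := fun z => (c.1 + z.2 • (z.1.1 - c.1), z.1.2)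
  have hφ : ContDiff ℝ ∞ φ := by fun_prop
  have hh : ContDiff ℝ ∞ (fun z : (X × Y) × ℝ => G (φ z) (z.1.1 - c.1)) := by fun_prop
  refine ⟨fun z => ∫ t in (0 : ℝ)..1, G (φ (z, t)) (z.1 - c.1), hh.intervalIntegral 0 1,
    _, hεW, Metric.isOpen_ball, Metric.mem_ball_self hε, fun z hz v => ?_⟩
  have hGd : Differentiable ℝ G := hG.differentiable (by simp)
  have hφmem : ∀ t ∈ Icc (0 : ℝ) 1, φ (z, t) ∈ Metric.ball c ε := by
    intro t ht
    rw [Metric.mem_ball, Prod.dist_eq, max_lt_iff] at hz ⊢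
    refine ⟨lt_of_le_of_lt ?_ hz.1, hz.2⟩
    simp only [φ, dist_eq_norm, add_sub_cancel_left, norm_smul, Real.norm_of_nonneg ht.1]
    exact mul_le_of_le_one_left (norm_nonneg _) ht.2
  have hsymmG : ∀ t ∈ Icc (0 : ℝ) 1, ∀ u v : X,
      fderiv ℝ G (φ (z, t)) (u, 0) v = fderiv ℝ G (φ (z, t)) (v, 0) u := by
    intro t ht
    rw [(hGg.eventuallyEq_of_mem (Metric.isOpen_ball.mem_nhds (hφmem t ht))).fderiv_eq]
    exact hsymm _ (hεW (hφmem t ht))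
  have hD : ∀ t, fderiv ℝ (fun z : (X × Y) × ℝ => G (φ z) (z.1.1 - c.1)) (z, t) ((v, 0), 0) =
      G (φ (z, t)) v + t * fderiv ℝ G (φ (z, t)) (v, 0) (z.1 - c.1) := by
    intro t
    have h0 : HasFDerivAt (fun z : (X × Y) × ℝ => z.1)
        (ContinuousLinearMap.fst ℝ (X × Y) ℝ) (z, t) := hasFDerivAt_fst
    have h1 : HasFDerivAt (fun z : (X × Y) × ℝ => z.1.1 - c.1) _ (z, t) :=
      h0.fst.sub_const c.1
    have h2 : HasFDerivAt φ _ (z, t) :=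
      ((hasFDerivAt_snd.smul h1).const_add c.1).prodMk h0.snd
    have h3 := ((hGd (φ (z, t))).hasFDerivAt.comp (z, t) h2).clm_apply h1
    refine (DFunLike.congr_fun h3.fderiv ((v, 0), 0)).trans ?_
    have : fderiv ℝ G (φ (z, t)) (t • v, 0) = t • fderiv ℝ G (φ (z, t)) (v, 0) := by
      rw [← map_smul, Prod.smul_mk, smul_zero]
    simp [this, mul_sub]
  have hline : ∀ t, HasDerivAt (fun t => t * G (φ (z, t)) v)
      (G (φ (z, t)) v + t * fderiv ℝ G (φ (z, t)) (z.1 - c.1, 0) v) t := by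
    intro t
    have h2 : HasDerivAt (fun t => φ (z, t)) (z.1 - c.1, 0) t := by
      have := (((hasDerivAt_id t).smul_const (z.1 - c.1)).const_add c.1).prodMk
        (hasDerivAt_const t z.2)
      simpa using this
    have h3 : HasDerivAt (fun t => G (φ (z, t)) v)
        (fderiv ℝ G (φ (z, t)) (z.1 - c.1, 0) v) t := by
      have := ((hGd (φ (z, t))).hasFDerivAt.comp_hasDerivAt t h2)
      exact (ContinuousLinearMap.apply ℝ ℝ v).hasFDerivAt.comp_hasDerivAt t this
    simpa using (hasDerivAt_id' t).fun_mul h3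
  have hcD : Continuous fun t => fderiv ℝ (fun z : (X × Y) × ℝ => G (φ z) (z.1.1 - c.1)) (z, t) :=
    (hh.continuous_fderiv (by simp)).comp (Continuous.prodMk_right z)
  rw [((hh.of_le (by simp)).hasFDerivAt_intervalIntegral 0 1 z).fderiv,
    ContinuousLinearMap.intervalIntegral_apply
      (Continuous.intervalIntegrable (by fun_prop) _ _)]
  simp only [ContinuousLinearMap.comp_apply, ContinuousLinearMap.inl_apply]
  rw [intervalIntegral.integral_eq_sub_of_hasDerivAt (f := fun t => t * G (φ (z, t)) v)]
  · simp [φ, hGg hz]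
  · intro t ht
    rw [uIcc_of_le zero_le_one] at ht
    rw [hD, hsymmG t ht]
    exact hline t
  · exact Continuous.intervalIntegrable (by fun_prop) _ _

theorem Matrix.exists_det_add_smul_ne_zero {n : Type*} [Fintype n] [DecidableEq n]
    {B C : Matrix n n ℝ} (hsymm : B * Cᵀ = C * Bᵀ)
    (hind : LinearIndependent ℝ (Matrix.fromCols B C).row) :
    ∃ s : ℝ, (C + s • B).det ≠ 0 := by
  have hG : (C * Cᵀ + B * Bᵀ).det ≠ 0 := by
    have h : (C * Cᵀ + B * Bᵀ) = fromCols B C * (fromCols B C)ᴴ := by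
      rw [conjTranspose_eq_transpose_of_trivial, transpose_fromCols, fromCols_mul_fromRows,
        add_comm]
    rw [h]
    refine (PosDef.mul_conjTranspose_self _ ?_).det_pos.ne'
    exact Matrix.vecMul_injective_iff.2 hind
  by_contra! h
  let P : Polynomial ℝ :=
    (C.map Polynomial.C + (Polynomial.X : Polynomial ℝ) • B.map Polynomial.C).det
  have hP : P = 0 := by
    refine Polynomial.funext fun s => ?_
    rw [Polynomial.eval_zero, ← h s, ← Polynomial.coe_evalRingHom, RingHom.map_det]
    congr 1
    ext i j
    simp
    exact mul_comm _ _
  let c := Complex.ofRealHom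
  have hI : (C.map c + Complex.I • B.map c).det = 0 := by
    rw [← map_zero (Polynomial.aeval (R := ℝ) Complex.I), ← hP, AlgHom.map_det]
    congr 1
    ext i j
    simp [c]
    exact mul_comm _ _
  have hBC : B.map c * (C.map c)ᵀ = C.map c * (B.map c)ᵀ := by
    rw [← transpose_map, ← transpose_map, ← Matrix.map_mul, ← Matrix.map_mul, hsymm]
  have hfac : (C * Cᵀ + B * Bᵀ).map c =
      (C.map c + Complex.I • B.map c) * (C.map c - Complex.I • B.map c)ᵀ := by
    rw [transpose_sub, transpose_smul, add_mul, mul_sub, mul_sub, smul_mul, smul_mul,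
      Matrix.mul_smul, Matrix.mul_smul, hBC, smul_smul, Complex.I_mul_I,
      Matrix.map_add _ (map_add c), Matrix.map_mul, Matrix.map_mul, transpose_map, transpose_map]
    simp
    abel
  have hdet := congrArg det hfac
  rw [det_mul, hI, zero_mul] at hdet
  exact hG (Complex.ofReal_eq_zero.1 ((c.map_det (C * Cᵀ + B * Bᵀ)).trans hdet))

theorem Matrix.symplectic_block_identities {n R : Type*} [Fintype n] [DecidableEq n] [CommRing R]
    {B C M N : Matrix n n R} (hBC : B * Cᵀ = C * Bᵀ) (hCM : C * M = 1) (hN : Nᵀ = N) :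
    (Mᵀ + N * B) * Cᵀ - N * C * Bᵀ = 1 ∧
      (Mᵀ + N * B) * (N * C)ᵀ - N * C * (Mᵀ + N * B)ᵀ = 0 := by
  have h1 : Mᵀ * Cᵀ = 1 := by rw [← transpose_mul, hCM, transpose_one]
  constructor
  · rw [add_mul, h1, mul_assoc, mul_assoc, hBC, add_sub_cancel_right]
  · have h2 : Mᵀ * (Cᵀ * N) = N := by rw [← mul_assoc, h1, one_mul]
    have h3 : N * C * M = N := by rw [mul_assoc, hCM, mul_one]
    rw [transpose_mul, transpose_add, transpose_mul, transpose_transpose, hN, add_mul, mul_add,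
      h2, h3]
    have : N * B * (Cᵀ * N) = N * C * (Bᵀ * N) := by
      rw [mul_assoc, ← mul_assoc B, hBC]; simp only [mul_assoc]
    rw [this]; abel

theorem Matrix.transpose_eq_of_add_mul_eq_zero {n R : Type*} [Fintype n] [DecidableEq n]
    [CommRing R] {B C M F : Matrix n n R} (hBC : B * Cᵀ = C * Bᵀ) (hCM : C * M = 1)
    (hF : B + C * F = 0) : Fᵀ = F := by
  have hMC : M * C = 1 := mul_eq_one_comm.1 hCM
  have hB : B = -(C * F) := eq_neg_of_add_eq_zero_left hF
  have h1 : Cᵀ * Mᵀ = 1 := by rw [← transpose_mul, hMC, transpose_one]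
  rw [hB, transpose_neg, transpose_mul, neg_mul, mul_neg, neg_inj] at hBC
  have : M * (C * F * Cᵀ) * Mᵀ = M * (C * (Fᵀ * Cᵀ)) * Mᵀ := by rw [hBC]
  simp only [← mul_assoc, hMC, one_mul] at this
  simpa only [mul_assoc, h1, mul_one, eq_comm] using this

/-- Smooth inverse function theorem, with an inverse that is smooth on its whole domain. -/
theorem exists_openPartialHomeomorph_contDiffOn_symm {E : Type*} [NormedAddCommGroup E]
    [NormedSpace ℝ E] [FiniteDimensional ℝ E]
    {f : E → E} {V : Set E} {m : E} (hV : IsOpen V) (hm : m ∈ V)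
    (hf : ContDiffOn ℝ ∞ f V) (hf' : Function.Injective (fderiv ℝ f m)) :
    ∃ e : OpenPartialHomeomorph E E, m ∈ e.source ∧ e.source ⊆ V ∧ (e : E → E) = f ∧
      ContDiffOn ℝ ∞ e.symm e.target := by
  have : CompleteSpace E := FiniteDimensional.complete ℝ E
  have hmc := hf.contDiffAt (hV.mem_nhds hm)
  let f'm : E ≃L[ℝ] E :=
    (LinearEquiv.ofInjectiveEndo (fderiv ℝ f m : E →ₗ[ℝ] E) hf').toContinuousLinearEquiv
  have hf'm : (f'm : E →L[ℝ] E) = fderiv ℝ f m := by ext v; rfl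
  have hfm : HasFDerivAt f (f'm : E →L[ℝ] E) m :=
    hf'm ▸ (hmc.differentiableAt (by simp)).hasFDerivAt
  have hVc : ContinuousOn (fderiv ℝ f) V := hf.continuousOn_fderiv_of_isOpen hV (by simp)
  set R : Set (E →L[ℝ] E) := range ((↑) : (E ≃L[ℝ] E) → E →L[ℝ] E)
  have hW : IsOpen (V ∩ fderiv ℝ f ⁻¹' R) :=
    hVc.isOpen_inter_preimage hV ContinuousLinearEquiv.isOpen
  let e := (hmc.toOpenPartialHomeomorph f hfm (by simp)).restrOpen _ hW
  refine ⟨e, ⟨hmc.mem_toOpenPartialHomeomorph_source hfm (by simp), hm, f'm, hf'm⟩,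
    fun x hx => hx.2.1, rfl, fun y hy => ?_⟩
  obtain ⟨hxV, g', hg'⟩ := (e.map_target hy).2
  have hd := hf.contDiffAt (hV.mem_nhds hxV)
  refine (e.contDiffAt_symm hy (f₀' := g') ?_ hd).contDiffWithinAt
  rw [hg']
  exact (hd.differentiableAt (by simp)).hasFDerivAt

theorem ContinuousLinearMap.apply_prod_pi {r : ℕ} {F : Type*} [NormedAddCommGroup F]
    [NormedSpace ℝ F] (L : E2 r →L[ℝ] F) (v : E2 r) :
    L v = ∑ i, v.1 i • L (Pi.single i 1, 0) + ∑ i, v.2 i • L (0, Pi.single i 1) := by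
  have h (w : Fin r → ℝ) : ∑ i, w i • Pi.single i (1 : ℝ) = w := by
    simpa using (Pi.basisFun ℝ (Fin r)).sum_repr w
  have hv : v = ∑ i, v.1 i • ((Pi.single i 1, 0) : E2 r) +
      ∑ i, v.2 i • ((0, Pi.single i 1) : E2 r) := by
    ext1 <;> simp [Prod.fst_sum, Prod.snd_sum, h]
  conv_lhs => rw [hv]
  simp only [map_add, map_sum, map_smul]

/-- The matrix `(∂f_i/∂q_k)`. -/
noncomputable def dqMatrix {r : ℕ} (f : Fin r → E2 r → ℝ) (x : E2 r) : Matrix (Fin r) (Fin r) ℝ :=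
  Matrix.of fun i k => dq k (f i) x

/-- The matrix `(∂f_i/∂p_k)`. -/
noncomputable def dpMatrix {r : ℕ} (f : Fin r → E2 r → ℝ) (x : E2 r) : Matrix (Fin r) (Fin r) ℝ :=
  Matrix.of fun i k => dp k (f i) x

theorem sbrak_eq_matrix {r : ℕ} (f g : Fin r → E2 r → ℝ) (x : E2 r) (i j : Fin r) :
    sbrak (f i) (g j) x =
      (dqMatrix f x * (dpMatrix g x)ᵀ - dpMatrix f x * (dqMatrix g x)ᵀ) i j := by
  simp only [sbrak, Finset.sum_sub_distrib, Matrix.sub_apply, Matrix.mul_apply, dqMatrix, dpMatrix,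
    Matrix.of_apply, Matrix.transpose_apply]
  exact congrArg _ (Finset.sum_congr rfl fun _ _ => mul_comm _ _)

theorem dqMatrix_mul_transpose_dpMatrix {r : ℕ} {f : Fin r → E2 r → ℝ} {x : E2 r}
    (h : ∀ i j, sbrak (f i) (f j) x = 0) :
    dqMatrix f x * (dpMatrix f x)ᵀ = dpMatrix f x * (dqMatrix f x)ᵀ := by
  refine sub_eq_zero.1 (Matrix.ext fun i j => ?_)
  rw [← sbrak_eq_matrix, h, Matrix.zero_apply]

/-- The Hamiltonian vector field of `g`. -/
noncomputable def hamiltonianVector {r : ℕ} (g : E2 r → ℝ) (x : E2 r) : E2 r :=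
  (fun i => dp i g x, fun i => -dq i g x)

theorem fderiv_hamiltonianVector {r : ℕ} (f g : E2 r → ℝ) (x : E2 r) :
    fderiv ℝ f x (hamiltonianVector g x) = sbrak f g x := by
  rw [ContinuousLinearMap.apply_prod_pi, sbrak, ← Finset.sum_add_distrib]
  refine Finset.sum_congr rfl fun i _ => ?_
  simp only [hamiltonianVector, dq, dp, smul_eq_mul]
  ring

theorem sbrak_swap {r : ℕ} (f g : E2 r → ℝ) (x : E2 r) : sbrak g f x = -sbrak f g x := by
  rw [sbrak, sbrak, ← Finset.sum_neg_distrib]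
  exact Finset.sum_congr rfl fun i _ => by ring

/-- The linear symplectic shear `(q, p) ↦ (q + s p, p)`. -/
noncomputable def shear (r : ℕ) (s : ℝ) : E2 r ≃L[ℝ] E2 r :=
  LinearEquiv.toContinuousLinearEquiv
    { toFun := fun x => (x.1 + s • x.2, x.2)
      invFun := fun x => (x.1 - s • x.2, x.2)
      map_add' := fun x y => by ext <;> simp; ring
      map_smul' := fun c x => by ext <;> simp; ring
      left_inv := fun x => by simp
      right_inv := fun x => by simp }

theorem shear_apply {r : ℕ} (s : ℝ) (x : E2 r) : shear r s x = (x.1 + s • x.2, x.2) := rfl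

theorem dq_comp_shear {r : ℕ} (s : ℝ) (f : E2 r → ℝ) (i : Fin r) (x : E2 r) :
    dq i (f ∘ shear r s) x = dq i f (shear r s x) := by
  rw [dq, dq, ContinuousLinearEquiv.comp_right_fderiv]
  simp [shear_apply]

theorem dp_comp_shear {r : ℕ} (s : ℝ) (f : E2 r → ℝ) (i : Fin r) (x : E2 r) :
    dp i (f ∘ shear r s) x = dp i f (shear r s x) + s * dq i f (shear r s x) := by
  have h : ((s • Pi.single i 1, Pi.single i 1) : E2 r) =
    (0, Pi.single i 1) + s • (Pi.single i 1, 0) := by simp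
  rw [dp, dp, dq, ContinuousLinearEquiv.comp_right_fderiv, ContinuousLinearMap.comp_apply,
    ContinuousLinearEquiv.coe_coe, shear_apply s (0, _), zero_add, h, map_add, map_smul,
    smul_eq_mul]

theorem sbrak_comp_shear {r : ℕ} (s : ℝ) (f g : E2 r → ℝ) (x : E2 r) :
    sbrak (f ∘ shear r s) (g ∘ shear r s) x = sbrak f g (shear r s x) := by
  simp only [sbrak, dq_comp_shear, dp_comp_shear]
  exact Finset.sum_congr rfl fun i _ => by ring

theorem linearIndependent_row_fromCols {r : ℕ} {f : Fin r → E2 r → ℝ} {x : E2 r}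
    (h : LinearIndependent ℝ fun i => fderiv ℝ (f i) x) :
    LinearIndependent ℝ (Matrix.fromCols (dqMatrix f x) (dpMatrix f x)).row := by
  rw [Fintype.linearIndependent_iff] at h ⊢
  refine fun c hc => h c (ContinuousLinearMap.ext fun v => ?_)
  have h1 : ∀ k, (∑ i, c i • fderiv ℝ (f i) x) (Pi.single k 1, 0) = 0 := fun k => by
    simpa [Matrix.row, dqMatrix, dq] using congrFun hc (Sum.inl k)
  have h2 : ∀ k, (∑ i, c i • fderiv ℝ (f i) x) (0, Pi.single k 1) = 0 := fun k => by
    simpa [Matrix.row, dpMatrix, dp] using congrFun hc (Sum.inr k)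
  rw [ContinuousLinearMap.apply_prod_pi]
  simp only [h1, h2]
  simp

/-- The continuous bilinear dot product on `Fin r → ℝ`. -/
noncomputable def dotCLM (r : ℕ) : (Fin r → ℝ) →L[ℝ] (Fin r → ℝ) →L[ℝ] ℝ :=
  ∑ i, (ContinuousLinearMap.proj i : (Fin r → ℝ) →L[ℝ] ℝ).smulRight
    (ContinuousLinearMap.proj i : (Fin r → ℝ) →L[ℝ] ℝ)

theorem dotCLM_apply {r : ℕ} (u v : Fin r → ℝ) : dotCLM r u v = u ⬝ᵥ v := by
  simp [dotCLM, dotProduct]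

theorem fderiv_eq_mulVec {r : ℕ} (f : Fin r → E2 r → ℝ) (x v : E2 r) :
    (fun i => fderiv ℝ (f i) x v) = dqMatrix f x *ᵥ v.1 + dpMatrix f x *ᵥ v.2 := by
  ext i
  rw [ContinuousLinearMap.apply_prod_pi]
  simp [Matrix.mulVec, dotProduct, dqMatrix, dpMatrix, dq, dp, mul_comm]

/-- Conjugate functions from a generating function: solve `p(x, y) = P` for `y = g(x, P)`, write
`g = ∂S/∂x` and take `q = ∂S/∂P`. -/
theorem exists_conjugate_of_det_ne_zero {r : ℕ} {m : E2 r} {V : Set (E2 r)} (hV : IsOpen V)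
    (hm : m ∈ V) {p : Fin r → E2 r → ℝ} (hps : ∀ i, ContDiffOn ℝ ∞ (p i) V)
    (hpinv : ∀ i j, ∀ x ∈ V, sbrak (p i) (p j) x = 0) (hdet : (dpMatrix p m).det ≠ 0) :
    ∃ U : Set (E2 r), IsOpen U ∧ m ∈ U ∧ U ⊆ V ∧ ∃ q : Fin r → E2 r → ℝ,
      (∀ i, ContDiffOn ℝ ∞ (q i) U) ∧
      (∀ x ∈ U, ∀ i j, sbrak (q i) (p j) x = if i = j then 1 else 0) ∧
      (∀ x ∈ U, ∀ i j, sbrak (q i) (q j) x = 0) := by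
  let Θ : E2 r → E2 r := fun x => (x.1, fun i => p i x)
  have hΘ : ContDiffOn ℝ ∞ Θ V := contDiffOn_fst.prodMk (contDiffOn_pi.2 hps)
  have hΘd : ∀ x ∈ V, ∀ v, fderiv ℝ Θ x v = (v.1, fun i => fderiv ℝ (p i) x v) := by
    intro x hx v
    have h : HasFDerivAt Θ ((ContinuousLinearMap.fst ℝ _ _).prod
        (ContinuousLinearMap.pi fun i => fderiv ℝ (p i) x)) x :=
      hasFDerivAt_fst.prodMk (hasFDerivAt_pi.2 fun i =>
        (((hps i).contDiffAt (hV.mem_nhds hx)).differentiableAt (by simp)).hasFDerivAt)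
    rw [h.fderiv]
    rfl
  have hinj : Function.Injective (fderiv ℝ Θ m) := by
    refine (injective_iff_map_eq_zero _).2 fun v hv => ?_
    rw [hΘd m hm, fderiv_eq_mulVec, Prod.mk_eq_zero] at hv
    obtain ⟨h1, h2⟩ := hv
    rw [h1, Matrix.mulVec_zero, zero_add] at h2
    exact Prod.ext h1 (Matrix.eq_zero_of_mulVec_eq_zero hdet h2)
  obtain ⟨e, hme, heV, heΘ, hes⟩ := exists_openPartialHomeomorph_contDiffOn_symm hV hm hΘ hinj
  have hesd : ∀ ξ ∈ e.target, DifferentiableAt ℝ e.symm ξ := fun ξ hξ =>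
    (hes.contDiffAt (e.open_target.mem_nhds hξ)).differentiableAt (by simp)
  let g : E2 r → Fin r → ℝ := fun ξ => (e.symm ξ).2
  have hg : ContDiffOn ℝ ∞ g e.target := hes.snd
  have hgd : ∀ ξ ∈ e.target, DifferentiableAt ℝ g ξ := fun ξ hξ => (hesd ξ hξ).snd
  have himpl : ∀ ξ ∈ e.target, ∀ v : E2 r, dqMatrix p (e.symm ξ) *ᵥ v.1 +
      dpMatrix p (e.symm ξ) *ᵥ fderiv ℝ g ξ v = v.2 := by
    intro ξ hξ v
    have hz := heV (e.map_target hξ)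
    have hΘz := ((hΘ.contDiffAt (hV.mem_nhds hz)).differentiableAt (by simp)).hasFDerivAt
    have hid : HasFDerivAt (Θ ∘ e.symm) (ContinuousLinearMap.id ℝ (E2 r)) ξ := by
      refine (hasFDerivAt_id ξ).congr_of_eventuallyEq ?_
      filter_upwards [e.open_target.mem_nhds hξ] with y hy
      rw [← heΘ]
      exact e.right_inv hy
    have hv := DFunLike.congr_fun
      ((hΘz.comp ξ (hesd ξ hξ).hasFDerivAt).unique hid) v
    rw [ContinuousLinearMap.comp_apply, hΘd _ hz, fderiv_eq_mulVec] at hv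
    obtain ⟨h1, h2⟩ := Prod.ext_iff.1 hv
    have hsnd : fderiv ℝ g ξ v = (fderiv ℝ e.symm ξ v).2 := by
      rw [(hesd ξ hξ).hasFDerivAt.snd.fderiv]
      rfl
    rw [hsnd]
    simp only [ContinuousLinearMap.id_apply] at h1 h2
    rw [h1] at h2
    exact h2
  let M : E2 r → Matrix (Fin r) (Fin r) ℝ := fun ξ =>
    Matrix.of fun i k => fderiv ℝ g ξ (0, Pi.single k 1) i
  have hCM : ∀ ξ ∈ e.target, dpMatrix p (e.symm ξ) * M ξ = 1 := by
    intro ξ hξ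
    ext l k
    have := congrFun (himpl ξ hξ (0, Pi.single k 1)) l
    simpa [Matrix.mulVec, dotProduct, Matrix.mul_apply, M, Matrix.one_apply, Pi.single_apply]
      using this
  have hsymm : ∀ ξ ∈ e.target, ∀ u v : Fin r → ℝ,
      fderiv ℝ (fun ξ => dotCLM r (g ξ)) ξ (u, 0) v =
        fderiv ℝ (fun ξ => dotCLM r (g ξ)) ξ (v, 0) u := by
    intro ξ hξ u v
    have hz := heV (e.map_target hξ)
    let F : Matrix (Fin r) (Fin r) ℝ := Matrix.of fun i k => fderiv ℝ g ξ (Pi.single k 1, 0) i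
    have hF : dqMatrix p (e.symm ξ) + dpMatrix p (e.symm ξ) * F = 0 := by
      ext l k
      have := congrFun (himpl ξ hξ (Pi.single k 1, 0)) l
      simpa [Matrix.mulVec, dotProduct, Matrix.mul_apply, F, Pi.single_apply] using this
    have hFt := Matrix.transpose_eq_of_add_mul_eq_zero
      (dqMatrix_mul_transpose_dpMatrix fun i j => hpinv i j _ hz) (hCM ξ hξ) hF
    have hFv : ∀ w : Fin r → ℝ, fderiv ℝ g ξ (w, 0) = F *ᵥ w := by
      intro w
      ext i
      rw [ContinuousLinearMap.apply_prod_pi]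
      simp [F, Matrix.mulVec, dotProduct, mul_comm]
    have hdd : fderiv ℝ (fun ξ => dotCLM r (g ξ)) ξ = (dotCLM r).comp (fderiv ℝ g ξ) :=
      ((dotCLM r).hasFDerivAt.comp ξ (hgd ξ hξ).hasFDerivAt).fderiv
    rw [hdd, ContinuousLinearMap.comp_apply, ContinuousLinearMap.comp_apply, dotCLM_apply,
      dotCLM_apply, hFv, hFv, dotProduct_comm, Matrix.dotProduct_mulVec, ← Matrix.mulVec_transpose,
      hFt]
  have hΘm : Θ m ∈ e.target := heΘ ▸ e.map_source hme
  obtain ⟨S, hS, W, hWt, hW, hmW, hSg⟩ := exists_contDiff_partial_primitive e.open_target hΘm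
    ((dotCLM r).contDiff.comp_contDiffOn hg) hsymm
  have hS' : ContDiff ℝ ∞ (fderiv ℝ S) := (contDiff_infty_iff_fderiv.1 hS).2
  have hS'd : Differentiable ℝ (fderiv ℝ S) := hS'.differentiable (by simp)
  have hUV : e.source ∩ e ⁻¹' W ⊆ V := fun x hx => heV hx.1
  let q : Fin r → E2 r → ℝ := fun k x => fderiv ℝ S (Θ x) (0, Pi.single k 1)
  have hbrak : ∀ x ∈ e.source ∩ e ⁻¹' W,
      dqMatrix q x * (dpMatrix p x)ᵀ - dpMatrix q x * (dqMatrix p x)ᵀ = 1 ∧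
      dqMatrix q x * (dpMatrix q x)ᵀ - dpMatrix q x * (dqMatrix q x)ᵀ = 0 := by
    rintro x ⟨hxe, hxW⟩
    have hxV := heV hxe
    rw [heΘ, mem_preimage] at hxW
    have hxt := hWt hxW
    have hex : e.symm (Θ x) = x := by rw [← heΘ]; exact e.left_inv hxe
    have hsnd : ∀ u v, fderiv ℝ (fderiv ℝ S) (Θ x) u v = fderiv ℝ (fderiv ℝ S) (Θ x) v u :=
      (hS.contDiffAt.isSymmSndFDerivAt (by
        rw [minSmoothness_of_isRCLikeNormedField]; exact ENat.LEInfty.out)).eq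
    let N : Matrix (Fin r) (Fin r) ℝ := Matrix.of fun k l =>
      fderiv ℝ (fderiv ℝ S) (Θ x) (0, Pi.single l 1) (0, Pi.single k 1)
    have hN : Nᵀ = N := by
      ext k l
      exact hsnd _ _
    have hMS : ∀ i k, fderiv ℝ (fderiv ℝ S) (Θ x) (Pi.single i 1, 0) (0, Pi.single k 1) =
        M (Θ x) i k := by
      intro i k
      rw [hsnd]
      have h1 : HasFDerivAt (fun ξ => fderiv ℝ S ξ (Pi.single i 1, 0)) _ (Θ x) :=
        (ContinuousLinearMap.apply ℝ ℝ ((Pi.single i 1, 0) : E2 r)).hasFDerivAt.comp (Θ x)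
          (hS'd (Θ x)).hasFDerivAt
      have h2 : HasFDerivAt (fun ξ => g ξ i) _ (Θ x) :=
        (hasFDerivAt_pi'.1 (hgd _ hxt).hasFDerivAt) i
      have h3 : (fun ξ => fderiv ℝ S ξ (Pi.single i 1, 0)) =ᶠ[𝓝 (Θ x)] fun ξ => g ξ i := by
        filter_upwards [hW.mem_nhds hxW] with ξ hξ
        rw [hSg ξ hξ, Function.comp_apply, dotCLM_apply, dotProduct_single_one]
      exact DFunLike.congr_fun (h1.unique (h2.congr_of_eventuallyEq h3)) (0, Pi.single k 1)
    have hqd : ∀ k v, fderiv ℝ (q k) x v = fderiv ℝ (fderiv ℝ S) (Θ x)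
        (v.1, fun l => fderiv ℝ (p l) x v) (0, Pi.single k 1) := by
      intro k v
      have h1 : HasFDerivAt (q k) _ x :=
        (ContinuousLinearMap.apply ℝ ℝ ((0, Pi.single k 1) : E2 r)).hasFDerivAt.comp x
          ((hS'd (Θ x)).hasFDerivAt.comp x
            ((hΘ.contDiffAt (hV.mem_nhds hxV)).differentiableAt (by simp)).hasFDerivAt)
      rw [h1.fderiv, ← hΘd x hxV]
      rfl
    have hq1 : dqMatrix q x = (M (Θ x))ᵀ + N * dqMatrix p x := by
      ext k i
      simp only [dqMatrix, Matrix.of_apply, dq, hqd]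
      rw [ContinuousLinearMap.apply_prod_pi (fderiv ℝ (fderiv ℝ S) (Θ x))]
      simp [Pi.single_apply, hMS, Matrix.mul_apply, N, mul_comm]
    have hq2 : dpMatrix q x = N * dpMatrix p x := by
      ext k i
      simp only [dpMatrix, Matrix.of_apply, dp, hqd]
      rw [ContinuousLinearMap.apply_prod_pi (fderiv ℝ (fderiv ℝ S) (Θ x))]
      simp [Matrix.mul_apply, N, mul_comm]
    rw [hq1, hq2]
    exact Matrix.symplectic_block_identities
      (dqMatrix_mul_transpose_dpMatrix fun i j => hpinv i j x hxV)
      (by simpa only [hex] using hCM _ hxt) hN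
  refine ⟨e.source ∩ e ⁻¹' W, e.isOpen_inter_preimage hW, ⟨hme, by rw [heΘ]; exact hmW⟩, hUV, q,
    fun i => ?_, fun x hx i j => ?_, fun x hx i j => ?_⟩
  · exact (hS'.comp_contDiffOn (hΘ.mono hUV)).clm_apply contDiffOn_const
  · rw [sbrak_eq_matrix, (hbrak x hx).1, Matrix.one_apply]
  · rw [sbrak_eq_matrix, (hbrak x hx).2, Matrix.zero_apply]

theorem exists_conjugate {r : ℕ} {m : E2 r} {V : Set (E2 r)} (hV : IsOpen V)
    (hm : m ∈ V) {p : Fin r → E2 r → ℝ} (hps : ∀ i, ContDiffOn ℝ ∞ (p i) V)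
    (hpinv : ∀ i j, ∀ x ∈ V, sbrak (p i) (p j) x = 0)
    (hind : LinearIndependent ℝ (fun i => fderiv ℝ (p i) m)) :
    ∃ U : Set (E2 r), IsOpen U ∧ m ∈ U ∧ U ⊆ V ∧ ∃ q : Fin r → E2 r → ℝ,
      (∀ i, ContDiffOn ℝ ∞ (q i) U) ∧
      (∀ x ∈ U, ∀ i j, sbrak (q i) (p j) x = if i = j then 1 else 0) ∧
      (∀ x ∈ U, ∀ i j, sbrak (q i) (q j) x = 0) := by
  obtain ⟨s, hs⟩ := Matrix.exists_det_add_smul_ne_zero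
    (dqMatrix_mul_transpose_dpMatrix fun i j => hpinv i j m hm)
    (linearIndependent_row_fromCols hind)
  let A := shear r s
  have hdet : (dpMatrix (fun i => p i ∘ A) (A.symm m)).det ≠ 0 := by
    convert hs using 2
    ext i k
    simp [dpMatrix, dqMatrix, A, dp_comp_shear]
  obtain ⟨U, hU, hmU, hUV, q, hq, hqp, hqq⟩ := exists_conjugate_of_det_ne_zero
    (m := A.symm m) (V := A ⁻¹' V) (hV.preimage A.continuous) (by simpa using hm)
    (p := fun i => p i ∘ A) (fun i => (hps i).comp A.contDiff.contDiffOn fun _ hx => hx)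
    (fun i j x hx => by rw [sbrak_comp_shear]; exact hpinv i j _ hx) hdet
  have hcomp : ∀ f : E2 r → ℝ, (f ∘ A.symm) ∘ A = f := fun f => by ext; simp
  have hbr : ∀ (f g : E2 r → ℝ) (x : E2 r), sbrak f g x = sbrak (f ∘ A) (g ∘ A) (A.symm x) := by
    intro f g x
    rw [sbrak_comp_shear]
    exact congrArg _ (A.apply_symm_apply x).symm
  refine ⟨A.symm ⁻¹' U, hU.preimage A.symm.continuous, hmU, fun x hx => by simpa using hUV hx,
    fun i => q i ∘ A.symm, fun i => (hq i).comp A.symm.contDiff.contDiffOn fun _ hx => hx,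
    fun x hx i j => ?_, fun x hx i j => ?_⟩
  · rw [hbr, hcomp]
    exact hqp _ hx i j
  · rw [hbr, hcomp, hcomp]
    exact hqq _ hx i j

theorem injective_fderiv_of_conjugate {r : ℕ} {p q : Fin r → E2 r → ℝ} {x : E2 r}
    (hp : ∀ i, DifferentiableAt ℝ (p i) x) (hq : ∀ i, DifferentiableAt ℝ (q i) x)
    (hpp : ∀ i j, sbrak (p i) (p j) x = 0)
    (hqp : ∀ i j, sbrak (q i) (p j) x = if i = j then 1 else 0)
    (hqq : ∀ i j, sbrak (q i) (q j) x = 0) :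
    Function.Injective
      (fderiv ℝ (fun x => ((fun i => p i x, fun i => q i x) : E2 r)) x) := by
  have h : HasFDerivAt (fun x => ((fun i => p i x, fun i => q i x) : E2 r))
      ((ContinuousLinearMap.pi fun i => fderiv ℝ (p i) x).prod
        (ContinuousLinearMap.pi fun i => fderiv ℝ (q i) x)) x :=
    (hasFDerivAt_pi.2 fun i => (hp i).hasFDerivAt).prodMk
      (hasFDerivAt_pi.2 fun i => (hq i).hasFDerivAt)
  rw [h.fderiv]
  refine LinearMap.injective_iff_surjective (f := ContinuousLinearMap.toLinearMap _).2 fun y =>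
    ⟨∑ j, y.2 j • hamiltonianVector (p j) x - ∑ j, y.1 j • hamiltonianVector (q j) x, ?_⟩
  have hpq : ∀ i j, sbrak (p i) (q j) x = if i = j then -1 else 0 := fun i j => by
    rw [sbrak_swap, hqp]
    simp [eq_comm, apply_ite]
  ext i
  · simp [fderiv_hamiltonianVector, hpp, hpq]
  · simp [fderiv_hamiltonianVector, hqp, hqq]

/-- The classical Carathéodory–Jacobi–Lie theorem: given `r` independent functions
`p₁, …, p_r` in involution vanishing at `m`, there exist complementary functions
`q₁, …, q_r` such that `(p₁,q₁,…,p_r,q_r)` is a canonical system of coordinates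
centered at `m`. -/
theorem classical_caratheodory_jacobi_lie {r : ℕ} (m : E2 r)
    (V : Set (E2 r)) (hV : IsOpen V) (hm : m ∈ V)
    (p : Fin r → E2 r → ℝ)
    (hps : ∀ i, ContDiffOn ℝ (⊤ : ℕ∞) (p i) V)
    (hp0 : ∀ i, p i m = 0)
    (hpinv : ∀ i j, ∀ x ∈ V, sbrak (p i) (p j) x = 0)
    (hind : LinearIndependent ℝ (fun i => fderiv ℝ (p i) m)) :
    ∃ U : Set (E2 r), IsOpen U ∧ m ∈ U ∧ U ⊆ V ∧
    ∃ q : Fin r → E2 r → ℝ,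
      (∀ i, ContDiffOn ℝ (⊤ : ℕ∞) (q i) U) ∧
      -- `(p₁,q₁,…,p_r,q_r)` is a diffeomorphism from `U` onto an open subset of `ℝ^{2r}`
      -- sending `m` to `0`
      (let Φ : E2 r → (Fin r → ℝ) × (Fin r → ℝ) :=
         fun x => (fun i => p i x, fun i => q i x)
       Φ m = 0 ∧ IsOpen (Φ '' U) ∧ Set.InjOn Φ U ∧ ContDiffOn ℝ (⊤ : ℕ∞) Φ U ∧
       ∃ Ψ : (Fin r → ℝ) × (Fin r → ℝ) → E2 r,
         ContDiffOn ℝ (⊤ : ℕ∞) Ψ (Φ '' U) ∧ ∀ x ∈ U, Ψ (Φ x) = x) ∧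
      -- canonical bracket relations on `U`
      (∀ x ∈ U, ∀ i j, sbrak (q i) (p j) x = if i = j then 1 else 0) ∧
      (∀ x ∈ U, ∀ i j, sbrak (q i) (q j) x = 0) := by
  obtain ⟨U₀, hU₀, hmU₀, hUV₀, q, hq, hqp, hqq⟩ := exists_conjugate hV hm hps hpinv hind
  have hbl : ∀ (f g : E2 r → ℝ) (c : ℝ) (x : E2 r),
      sbrak (fun y => f y - c) g x = sbrak f g x := by
    intro f g c x
    simp only [sbrak, dq, dp, fderiv_sub_const]
  have hbr : ∀ (f g : E2 r → ℝ) (c : ℝ) (x : E2 r),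
      sbrak f (fun y => g y - c) x = sbrak f g x := by
    intro f g c x
    simp only [sbrak, dq, dp, fderiv_sub_const]
  let q₀ : Fin r → E2 r → ℝ := fun i x => q i x - q i m
  have hq₀ : ∀ i, ContDiffOn ℝ ∞ (q₀ i) U₀ := fun i => (hq i).sub contDiffOn_const
  have hqp₀ : ∀ x ∈ U₀, ∀ i j, sbrak (q₀ i) (p j) x = if i = j then 1 else 0 :=
    fun x hx i j => (hbl _ _ _ _).trans (hqp x hx i j)
  have hqq₀ : ∀ x ∈ U₀, ∀ i j, sbrak (q₀ i) (q₀ j) x = 0 :=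
    fun x hx i j => (hbl _ _ _ _).trans ((hbr _ _ _ _).trans (hqq x hx i j))
  have hΦ : ContDiffOn ℝ ∞ (fun x => ((fun i => p i x, fun i => q₀ i x) : E2 r)) U₀ :=
    (contDiffOn_pi.2 fun i => (hps i).mono hUV₀).prodMk (contDiffOn_pi.2 hq₀)
  obtain ⟨e, hme, heU, heΦ, hes⟩ := exists_openPartialHomeomorph_contDiffOn_symm hU₀ hmU₀ hΦ
    (injective_fderiv_of_conjugate
      (fun i => ((hps i).contDiffAt (hV.mem_nhds hm)).differentiableAt (by simp))
      (fun i => ((hq₀ i).contDiffAt (hU₀.mem_nhds hmU₀)).differentiableAt (by simp))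
      (fun i j => hpinv i j m hm) (hqp₀ m hmU₀) (hqq₀ m hmU₀))
  refine ⟨e.source, e.open_source, hme, heU.trans hUV₀, q₀, fun i => (hq₀ i).mono heU, ?_,
    fun x hx => hqp₀ x (heU hx), fun x hx => hqq₀ x (heU hx)⟩
  intro Φ
  have heΦ' : (e : E2 r → E2 r) = Φ := heΦ
  rw [← heΦ', e.image_source_eq_target]
  refine ⟨?_, e.open_target, e.injOn, heΦ' ▸ hΦ.mono heU, e.symm, hes, fun x hx => e.left_inv hx⟩
  rw [heΦ']
  ext i
  · exact hp0 i
  · exact sub_self _
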